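/- Let n be a positive integer and let M be an R-module that satisfies the radical formula of degree n. Then for every submodule N of M, the semiprime radical equals the prime radical: S(N) = β(N). -/

import Mathlib

open Submodule

universe u v

/-- The envelope `E_M(N)` of a submodule `N` of `M`:
the set of elements `a • m` with `a ^ k • m ∈ N` for some positive integer `k`. -/
def envSet {R : Type u} [CommRing R] {M : Type v} [AddCommGroup M] [Module R M]
    (N : Submodule R M) : Set M :=
  {x | ∃ (a : R) (m : M) (k : ℕ), 0 < k ∧ a ^ k • m ∈ N ∧ x = a • m}

/-- The submodule `⟨E_M(N)⟩` generated by the envelope of `N`. -/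
def envSub {R : Type u} [CommRing R] {M : Type v} [AddCommGroup M] [Module R M]
    (N : Submodule R M) : Submodule R M :=
  Submodule.span R (envSet N)

/-- `chainSub N n = ⟨E_n(N)⟩`: the ascending chain with `⟨E_0(N)⟩ = N` and
`⟨E_{n+1}(N)⟩ = ⟨E_M(⟨E_n(N)⟩)⟩`. -/
def chainSub {R : Type u} [CommRing R] {M : Type v} [AddCommGroup M] [Module R M]
    (N : Submodule R M) : ℕ → Submodule R M
  | 0 => N
  | n + 1 => envSub (chainSub N n)

/-- A proper submodule `K` is semiprime if `a ^ 2 • m ∈ K` implies `a • m ∈ K`. -/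
def IsSemiprimeSub {R : Type u} [CommRing R] {M : Type v} [AddCommGroup M] [Module R M]
    (K : Submodule R M) : Prop :=
  K ≠ ⊤ ∧ ∀ (a : R) (m : M), a ^ 2 • m ∈ K → a • m ∈ K

/-- The semiprime radical `S(N)`: the intersection of all semiprime submodules containing `N`. -/
def spRadical {R : Type u} [CommRing R] {M : Type v} [AddCommGroup M] [Module R M]
    (N : Submodule R M) : Submodule R M :=
  sInf {K | IsSemiprimeSub K ∧ N ≤ K}

/-- A proper submodule `P` is prime if `a • m ∈ P` implies `m ∈ P` or `a • M ⊆ P`. -/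
def IsPrimeSub {R : Type u} [CommRing R] {M : Type v} [AddCommGroup M] [Module R M]
    (P : Submodule R M) : Prop :=
  P ≠ ⊤ ∧ ∀ (a : R) (m : M), a • m ∈ P → m ∈ P ∨ ∀ x : M, a • x ∈ P

/-- The prime radical `β(N)`: the intersection of all prime submodules containing `N`. -/
def primeRadical {R : Type u} [CommRing R] {M : Type v} [AddCommGroup M] [Module R M]
    (N : Submodule R M) : Submodule R M :=
  sInf {P | IsPrimeSub P ∧ N ≤ P}

/-- `Γ_a(M) = {m : a ^ k • m = 0 for some positive integer k}`. -/
def Gamma {R : Type u} [CommRing R] {M : Type v} [AddCommGroup M] [Module R M]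
    (a : R) : Submodule R M where
  carrier := {m | ∃ k : ℕ, 0 < k ∧ a ^ k • m = 0}
  zero_mem' := ⟨1, one_pos, smul_zero _⟩
  add_mem' := by
    rintro x y ⟨k, hk, hx⟩ ⟨l, hl, hy⟩
    refine ⟨k + l, by omega, ?_⟩
    have h1 : a ^ (k + l) • x = 0 := by rw [pow_add, mul_comm, mul_smul, hx, smul_zero]
    have h2 : a ^ (k + l) • y = 0 := by rw [pow_add, mul_smul, hy, smul_zero]
    rw [smul_add, h1, h2, add_zero]
  smul_mem' := by
    rintro c x ⟨k, hk, hx⟩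
    exact ⟨k, hk, by rw [smul_comm, hx, smul_zero]⟩

/-- `aΓ_a(M)`: the image of `Γ_a(M)` under multiplication by `a`. -/
def aGamma {R : Type u} [CommRing R] {M : Type v} [AddCommGroup M] [Module R M]
    (a : R) : Submodule R M :=
  (Gamma (M := M) a).map (LinearMap.lsmul R M a)

/-- An element `m` of an `R`-module is nilpotent if `m = Σ_{i=1}^r a_i • m_i` with
`a_i ^ k • m_i = 0` for all `i`, for some positive integers `r`, `k`. -/
def IsNilpotentElem (R : Type u) [CommRing R] {M : Type v} [AddCommGroup M] [Module R M]
    (m : M) : Prop :=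
  ∃ (r : ℕ) (a : Fin r → R) (x : Fin r → M) (k : ℕ),
    0 < r ∧ 0 < k ∧ m = ∑ i, a i • x i ∧ ∀ i, (a i) ^ k • x i = 0

/-- A reduced module: `a ^ k • m = 0` (for some positive `k`) implies `a • m = 0`,
i.e. `E_M(0) = 0`. -/
def IsReducedModule (R : Type u) [CommRing R] (M : Type v) [AddCommGroup M] [Module R M] : Prop :=
  ∀ (a : R) (m : M) (k : ℕ), 0 < k → a ^ k • m = 0 → a • m = 0

theorem IsPrimeSub.isSemiprimeSub {R : Type u} [CommRing R] {M : Type v} [AddCommGroup M]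
    [Module R M] {P : Submodule R M} (hP : IsPrimeSub P) : IsSemiprimeSub P := by
  refine ⟨hP.1, fun a m h => ?_⟩
  rw [pow_two, mul_smul] at h
  exact (hP.2 a (a • m) h).elim id fun h' => h' m

theorem IsSemiprimeSub.smul_mem_of_pow_smul_mem {R : Type u} [CommRing R] {M : Type v}
    [AddCommGroup M] [Module R M] {K : Submodule R M} (hK : IsSemiprimeSub K) {a : R} {m : M}
    (k : ℕ) (h : a ^ (k + 1) • m ∈ K) : a • m ∈ K := by
  induction k with
  | zero => simpa using h
  | succ k ih =>
    apply ih
    rw [pow_succ', mul_smul]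
    apply hK.2
    rwa [← mul_smul, ← pow_add, add_comm 2 k]

theorem IsSemiprimeSub.envSub_le {R : Type u} [CommRing R] {M : Type v} [AddCommGroup M]
    [Module R M] {N K : Submodule R M} (hK : IsSemiprimeSub K) (hN : N ≤ K) : envSub N ≤ K := by
  refine Submodule.span_le.2 ?_
  rintro x ⟨a, m, k, hk, h, rfl⟩
  obtain ⟨k, rfl⟩ := Nat.exists_eq_succ_of_ne_zero hk.ne'
  exact hK.smul_mem_of_pow_smul_mem k (hN h)

theorem IsSemiprimeSub.chainSub_le {R : Type u} [CommRing R] {M : Type v} [AddCommGroup M]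
    [Module R M] {N K : Submodule R M} (hK : IsSemiprimeSub K) (hN : N ≤ K) (n : ℕ) :
    chainSub N n ≤ K := by
  induction n with
  | zero => exact hN
  | succ n ih => exact hK.envSub_le ih

/-- If `M` satisfies the radical formula of degree `n` (`n ≥ 1`), then for
every submodule `N` of `M`, `S(N) = β(N)`. -/
theorem stmt6 {R : Type u} [CommRing R] {M : Type v} [AddCommGroup M] [Module R M]
    (n : ℕ) (hn : 0 < n)
    (hM : ∀ N : Submodule R M, chainSub N n = primeRadical N) :
    ∀ N : Submodule R M, spRadical N = primeRadical N := by
  intro N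
  apply le_antisymm
  · exact sInf_le_sInf fun P hP => ⟨hP.1.isSemiprimeSub, hP.2⟩
  · rw [← hM N]
    exact le_sInf fun K hK => hK.1.chainSub_le hK.2 n
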